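/- arXiv:2209.07822 — 7 statements merged into one kernel-verified Lean document; each statement's English description precedes it below -/
import Mathlib

section
/- Let σ₁:(M₁*,α₁*)→(L₁,α₁) and σ₂:(M₂*,α₂*)→(L₂,α₂) be relative central extensions of the pairs of regular Hom-Lie algebras (M₁,L₁) and (M₂,L₂), respectively. If (γ,β') is an isoclinism from σ₁ to σ₂, then γ(σ₁(x)) = σ₂(β'(x)) for all x ∈ [M₁*,L₁]. -/
/-- A Hom-Lie algebra over a field `K`: a vector space with a bilinear bracket `br`
and a linear twist map `a`, satisfying skew-symmetry and the Hom-Jacobi identity. -/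
structure HomLie (K : Type) [Field K] (L : Type) [AddCommGroup L] [Module K L] where
  br : L →ₗ[K] L →ₗ[K] L
  a : L →ₗ[K] L
  skew : ∀ x y, br x y = - br y x
  jacobi : ∀ x y z,
    br (a x) (br y z) + br (a y) (br z x) + br (a z) (br x y) = 0

namespace HomLie

variable {K L : Type} [Field K] [AddCommGroup L] [Module K L]

/-- A Hom-Lie algebra is regular if it is multiplicative and its twist is bijective. -/
def IsRegular (H : HomLie K L) : Prop :=
  (∀ x y, H.a (H.br x y) = H.br (H.a x) (H.a y)) ∧ Function.Bijective H.a

/-- A submodule `M` is an ideal of the Hom-Lie algebra if it is invariant under the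
twist and closed under bracketing with arbitrary elements. -/
def IsIdeal (H : HomLie K L) (M : Submodule K L) : Prop :=
  (∀ m ∈ M, H.a m ∈ M) ∧ ∀ m ∈ M, ∀ l, H.br m l ∈ M

/-- An abelian Hom-Lie algebra. -/
def IsAbelian (H : HomLie K L) : Prop := ∀ x y, H.br x y = 0

end HomLie

/-- `γ` is a homomorphism of Hom-Lie algebras. -/
def IsHomLieHom {K L₁ L₂ : Type} [Field K] [AddCommGroup L₁] [Module K L₁]
    [AddCommGroup L₂] [Module K L₂] (H₁ : HomLie K L₁) (H₂ : HomLie K L₂)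
    (γ : L₁ →ₗ[K] L₂) : Prop :=
  (∀ x y, γ (H₁.br x y) = H₂.br (γ x) (γ y)) ∧ ∀ x, γ (H₁.a x) = H₂.a (γ x)

/-- For a pair `(M, L)`, the center `Z(M,L) = {m ∈ M : [m,l] = 0 for all l ∈ L}`. -/
def pairCenter {K L : Type} [Field K] [AddCommGroup L] [Module K L]
    (HL : HomLie K L) (M : Submodule K L) : Submodule K L :=
  M ⊓ ⨅ l, LinearMap.ker (HL.br.flip l)

/-- For a pair `(M, L)`, the commutator `[M,L] = span{[m,l] : m ∈ M, l ∈ L}`. -/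
def pairComm {K L : Type} [Field K] [AddCommGroup L] [Module K L]
    (HL : HomLie K L) (M : Submodule K L) : Submodule K L :=
  Submodule.span K {x | ∃ m ∈ M, ∃ l, x = HL.br m l}

/-- A relative central extension of the pair `(M, L)`: a Hom-Lie homomorphism
`σ : M* → L` together with a Hom-action of `L` on `M*` such that `σ(M*) = M`,
`σ(^l α(m)) = [α_L l, σ(α m)]` and `^{σ m'} α(m) = [m', m]`. -/
structure RelCentExt (K L Mstar : Type) [Field K] [AddCommGroup L] [Module K L]
    [AddCommGroup Mstar] [Module K Mstar] (HL : HomLie K L) (M : Submodule K L) where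
  HM : HomLie K Mstar
  σ : Mstar →ₗ[K] L
  σ_br : ∀ m m', σ (HM.br m m') = HL.br (σ m) (σ m')
  σ_a : ∀ m, σ (HM.a m) = HL.a (σ m)
  act : L →ₗ[K] Mstar →ₗ[K] Mstar
  act_jac : ∀ x y k,
    act (HL.br x y) (HM.a k) = act (HL.a x) (act y k) - act (HL.a y) (act x k)
  act_brk : ∀ x k k',
    act (HL.a x) (HM.br k k') = HM.br (act x k) (HM.a k') + HM.br (HM.a k) (act x k')
  act_a : ∀ x k, HM.a (act x k) = act (HL.a x) (HM.a k)
  range_σ : LinearMap.range σ = M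
  σ_act : ∀ l m, σ (act l (HM.a m)) = HL.br (HL.a l) (σ (HM.a m))
  act_self : ∀ m m', act (σ m') (HM.a m) = HM.br m' m

namespace RelCentExt

variable {K L Mstar : Type} [Field K] [AddCommGroup L] [Module K L]
  [AddCommGroup Mstar] [Module K Mstar] {HL : HomLie K L} {M : Submodule K L}

/-- The `L`-commutator subalgebra `[M*, L] = span{^l α(m) : l ∈ L, m ∈ M*}`. -/
def comm (E : RelCentExt K L Mstar HL M) : Submodule K Mstar :=
  Submodule.span K {x | ∃ l m, x = E.act l (E.HM.a m)}

/-- A stem relative central extension: `Ker σ ⊆ [M*, L]`. -/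
def IsStem (E : RelCentExt K L Mstar HL M) : Prop :=
  LinearMap.ker E.σ ≤ E.comm

end RelCentExt

section Morphisms

variable {K L₁ L₂ M₁s M₂s : Type} [Field K]
  [AddCommGroup L₁] [Module K L₁] [AddCommGroup L₂] [Module K L₂]
  [AddCommGroup M₁s] [Module K M₁s] [AddCommGroup M₂s] [Module K M₂s]
  {HL₁ : HomLie K L₁} {HL₂ : HomLie K L₂}
  {M₁ : Submodule K L₁} {M₂ : Submodule K L₂}

/-- A morphism `(γ, β)` of relative central extensions. -/
def IsRCEMorphism (E₁ : RelCentExt K L₁ M₁s HL₁ M₁) (E₂ : RelCentExt K L₂ M₂s HL₂ M₂)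
    (γ : L₁ →ₗ[K] L₂) (β : M₁s →ₗ[K] M₂s) : Prop :=
  IsHomLieHom HL₁ HL₂ γ ∧ M₁.map γ = M₂ ∧
  IsHomLieHom E₁.HM E₂.HM β ∧ E₁.comm.map β = E₂.comm ∧
  ∀ m, γ (E₁.σ m) = E₂.σ (β m)

/-- An isoclinic morphism of relative central extensions: a morphism `(γ, β)` such that
`γ` is an isomorphism and `β` restricted to `[M₁*,L₁]` is a Hom-Lie isomorphism onto
`[M₂*,L₂]` compatible with the actions. -/
def IsIsoclinicMorphism (E₁ : RelCentExt K L₁ M₁s HL₁ M₁) (E₂ : RelCentExt K L₂ M₂s HL₂ M₂)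
    (γ : L₁ →ₗ[K] L₂) (β : M₁s →ₗ[K] M₂s) : Prop :=
  IsRCEMorphism E₁ E₂ γ β ∧ Function.Bijective γ ∧
  Set.InjOn β (E₁.comm : Set M₁s) ∧
  ∀ (l₁ : L₁) (m₁ : M₁s) (l₂ : L₂) (m₂ : M₂s),
    γ (E₁.σ (E₁.HM.a m₁)) = E₂.σ (E₂.HM.a m₂) → γ (HL₁.a l₁) = HL₂.a l₂ →
    β (E₁.act l₁ (E₁.HM.a m₁)) = E₂.act l₂ (E₂.HM.a m₂)

/-- An isoclinic epimorphism. -/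
def IsIsoclinicEpi (E₁ : RelCentExt K L₁ M₁s HL₁ M₁) (E₂ : RelCentExt K L₂ M₂s HL₂ M₂)
    (γ : L₁ →ₗ[K] L₂) (β : M₁s →ₗ[K] M₂s) : Prop :=
  IsIsoclinicMorphism E₁ E₂ γ β ∧ Function.Surjective β

/-- An isoclinic monomorphism. -/
def IsIsoclinicMono (E₁ : RelCentExt K L₁ M₁s HL₁ M₁) (E₂ : RelCentExt K L₂ M₂s HL₂ M₂)
    (γ : L₁ →ₗ[K] L₂) (β : M₁s →ₗ[K] M₂s) : Prop :=
  IsIsoclinicMorphism E₁ E₂ γ β ∧ Function.Injective β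

/-- `(γ, β')` is an isoclinism between the relative central extensions `E₁` and `E₂`. -/
def IsIsoclinism (E₁ : RelCentExt K L₁ M₁s HL₁ M₁) (E₂ : RelCentExt K L₂ M₂s HL₂ M₂)
    (γ : L₁ ≃ₗ[K] L₂) (β' : ↥E₁.comm ≃ₗ[K] ↥E₂.comm) : Prop :=
  IsHomLieHom HL₁ HL₂ γ.toLinearMap ∧ M₁.map γ.toLinearMap = M₂ ∧
  (∀ (x y : E₁.comm) (h : E₁.HM.br (x : M₁s) (y : M₁s) ∈ E₁.comm),
      (β' ⟨E₁.HM.br (x : M₁s) (y : M₁s), h⟩ : M₂s) = E₂.HM.br (β' x : M₂s) (β' y : M₂s)) ∧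
  (∀ (x : E₁.comm) (h : E₁.HM.a (x : M₁s) ∈ E₁.comm),
      (β' ⟨E₁.HM.a (x : M₁s), h⟩ : M₂s) = E₂.HM.a (β' x : M₂s)) ∧
  ∀ (l₁ : L₁) (m₁ : M₁s) (l₂ : L₂) (m₂ : M₂s),
    γ (E₁.σ (E₁.HM.a m₁)) = E₂.σ (E₂.HM.a m₂) → γ (HL₁.a l₁) = HL₂.a l₂ →
    ∀ h : E₁.act l₁ (E₁.HM.a m₁) ∈ E₁.comm,
      (β' ⟨E₁.act l₁ (E₁.HM.a m₁), h⟩ : M₂s) = E₂.act l₂ (E₂.HM.a m₂)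

/-- `γ` induces an isoclinism from `E₁` to `E₂`. -/
def InducesIsoclinism (E₁ : RelCentExt K L₁ M₁s HL₁ M₁) (E₂ : RelCentExt K L₂ M₂s HL₂ M₂)
    (γ : L₁ ≃ₗ[K] L₂) : Prop :=
  ∃ β', IsIsoclinism E₁ E₂ γ β'

/-- The relative central extensions `E₁` and `E₂` are isoclinic. -/
def AreIsoclinic (E₁ : RelCentExt K L₁ M₁s HL₁ M₁) (E₂ : RelCentExt K L₂ M₂s HL₂ M₂) : Prop :=
  ∃ γ β', IsIsoclinism E₁ E₂ γ β'

/-- The relative central extensions `E₁` and `E₂` are isomorphic. -/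
def AreIsomorphicRCE (E₁ : RelCentExt K L₁ M₁s HL₁ M₁) (E₂ : RelCentExt K L₂ M₂s HL₂ M₂) : Prop :=
  ∃ (γ : L₁ ≃ₗ[K] L₂) (β : M₁s ≃ₗ[K] M₂s),
    IsHomLieHom HL₁ HL₂ γ.toLinearMap ∧ M₁.map γ.toLinearMap = M₂ ∧
    IsHomLieHom E₁.HM E₂.HM β.toLinearMap ∧ E₁.comm.map β.toLinearMap = E₂.comm ∧
    ∀ m, γ (E₁.σ m) = E₂.σ (β m)

/-- The pullback subalgebra `M̄* = {(m₁,m₂) : γ σ₁ (α₁ m₁) = σ₂ (α₂ m₂)}`. -/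
def MbarSub (E₁ : RelCentExt K L₁ M₁s HL₁ M₁) (E₂ : RelCentExt K L₂ M₂s HL₂ M₂)
    (γ : L₁ →ₗ[K] L₂) : Submodule K (M₁s × M₂s) :=
  LinearMap.ker ((γ ∘ₗ E₁.σ ∘ₗ E₁.HM.a) ∘ₗ LinearMap.fst K M₁s M₂s
    - (E₂.σ ∘ₗ E₂.HM.a) ∘ₗ LinearMap.snd K M₁s M₂s)

end Morphisms

/-- A factor set on a relative central extension `E = σ`: a bilinear map
`f : L × L → Ker σ` with `f(l,l) = 0` satisfying the Hom-Jacobi type identity. -/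
structure FactorSet {K L Mstar : Type} [Field K] [AddCommGroup L] [Module K L]
    [AddCommGroup Mstar] [Module K Mstar] {HL : HomLie K L} {M : Submodule K L}
    (E : RelCentExt K L Mstar HL M) where
  f : L →ₗ[K] L →ₗ[K] Mstar
  mem_ker : ∀ x y, f x y ∈ LinearMap.ker E.σ
  alt : ∀ l, f l l = 0
  jac : ∀ l₁ l₂ l₃,
    f (HL.br l₁ l₂) (HL.a l₃) + f (HL.br l₂ l₃) (HL.a l₁) + f (HL.br l₃ l₁) (HL.a l₂) = 0

/-- `Ef` is the relative central extension `σ_f : (Ker σ × M)_f → L` associated to the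
factor set `fs` on `E`: the bracket is `[(x₁,m₁),(x₂,m₂)] = (f(m₁,m₂),[m₁,m₂])`, the
twist is `α_f(x,m) = (α_*(x), α_L(m))`, `σ_f(x,m) = m` and `^l(x,m) = (f(m,l),[m,l])`. -/
def IsFactorSetExt {K L Mstar : Type} [Field K] [AddCommGroup L] [Module K L]
    [AddCommGroup Mstar] [Module K Mstar] {HL : HomLie K L} {M : Submodule K L}
    (E : RelCentExt K L Mstar HL M) (fs : FactorSet E)
    (Ef : RelCentExt K L (↥(LinearMap.ker E.σ) × ↥M) HL M) : Prop :=
  (∀ p q : ↥(LinearMap.ker E.σ) × ↥M,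
      ((Ef.HM.br p q).1 : Mstar) = fs.f (p.2 : L) (q.2 : L) ∧
      ((Ef.HM.br p q).2 : L) = HL.br (p.2 : L) (q.2 : L)) ∧
  (∀ p : ↥(LinearMap.ker E.σ) × ↥M,
      ((Ef.HM.a p).1 : Mstar) = E.HM.a (p.1 : Mstar) ∧ ((Ef.HM.a p).2 : L) = HL.a (p.2 : L)) ∧
  (∀ p : ↥(LinearMap.ker E.σ) × ↥M, Ef.σ p = (p.2 : L)) ∧
  (∀ (l : L) (p : ↥(LinearMap.ker E.σ) × ↥M),
      ((Ef.act l p).1 : Mstar) = fs.f (p.2 : L) l ∧ ((Ef.act l p).2 : L) = HL.br (p.2 : L) l)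

/-- `Ebar` is the relative central extension `σ̄ : M*/N → L` induced by `E` on the
quotient by an ideal `N ⊆ Ker σ`. -/
def IsQuotientExt {K L Mstar : Type} [Field K] [AddCommGroup L] [Module K L]
    [AddCommGroup Mstar] [Module K Mstar] {HL : HomLie K L} {M : Submodule K L}
    (E : RelCentExt K L Mstar HL M) (N : Submodule K Mstar)
    (Ebar : RelCentExt K L (Mstar ⧸ N) HL M) : Prop :=
  (∀ m m', Ebar.HM.br (Submodule.Quotient.mk m) (Submodule.Quotient.mk m')
      = Submodule.Quotient.mk (E.HM.br m m')) ∧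
  (∀ m, Ebar.HM.a (Submodule.Quotient.mk m) = Submodule.Quotient.mk (E.HM.a m)) ∧
  (∀ m, Ebar.σ (Submodule.Quotient.mk m) = E.σ m) ∧
  (∀ l m, Ebar.act l (Submodule.Quotient.mk m) = Submodule.Quotient.mk (E.act l m))

/-- `Ep` is the product relative central extension `σ π_{M*} : M* × A → L` of `E` with
an abelian Hom-Lie algebra `(A, HA)`, with trivial action on the `A`-component. -/
def IsProdExt {K L Mstar A : Type} [Field K] [AddCommGroup L] [Module K L]
    [AddCommGroup Mstar] [Module K Mstar] [AddCommGroup A] [Module K A]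
    {HL : HomLie K L} {M : Submodule K L}
    (E : RelCentExt K L Mstar HL M) (HA : HomLie K A)
    (Ep : RelCentExt K L (Mstar × A) HL M) : Prop :=
  (∀ p q : Mstar × A, Ep.HM.br p q = (E.HM.br p.1 q.1, HA.br p.2 q.2)) ∧
  (∀ p : Mstar × A, Ep.HM.a p = (E.HM.a p.1, HA.a p.2)) ∧
  (∀ p : Mstar × A, Ep.σ p = E.σ p.1) ∧
  (∀ (l : L) (p : Mstar × A), Ep.act l p = (E.act l p.1, 0))

/-- A bundled relative central extension of a pair of Hom-Lie algebras over `K`. -/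
structure BundledRCE (K : Type) [Field K] where
  L : Type
  Ms : Type
  [grpL : AddCommGroup L]
  [modL : Module K L]
  [grpM : AddCommGroup Ms]
  [modM : Module K Ms]
  HL : HomLie K L
  M : Submodule K L
  E : RelCentExt K L Ms HL M

attribute [instance] BundledRCE.grpL BundledRCE.modL BundledRCE.grpM BundledRCE.modM

/-- A bundled Hom-Lie algebra over `K`. -/
structure BundledHomLie (K : Type) [Field K] where
  carrier : Type
  [grp : AddCommGroup carrier]
  [mod : Module K carrier]
  str : HomLie K carrier

attribute [instance] BundledHomLie.grp BundledHomLie.mod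

/-- Lemma 2.3(1): if (γ,β') is an isoclinism from σ₁ to σ₂, then
γ (σ₁ x) = σ₂ (β' x) for all x ∈ [M₁*, L₁]. -/
theorem stmt_0 {K L₁ L₂ M₁s M₂s : Type} [Field K]
    [AddCommGroup L₁] [Module K L₁] [AddCommGroup L₂] [Module K L₂]
    [AddCommGroup M₁s] [Module K M₁s] [AddCommGroup M₂s] [Module K M₂s]
    {HL₁ : HomLie K L₁} {HL₂ : HomLie K L₂}
    {M₁ : Submodule K L₁} {M₂ : Submodule K L₂}
    (hreg₁ : HL₁.IsRegular) (hid₁ : HL₁.IsIdeal M₁)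
    (hreg₂ : HL₂.IsRegular) (hid₂ : HL₂.IsIdeal M₂)
    (E₁ : RelCentExt K L₁ M₁s HL₁ M₁) (E₂ : RelCentExt K L₂ M₂s HL₂ M₂)
    (γ : L₁ ≃ₗ[K] L₂) (β' : ↥E₁.comm ≃ₗ[K] ↥E₂.comm)
    (hiso : IsIsoclinism E₁ E₂ γ β') :
    ∀ x : E₁.comm, γ (E₁.σ (x : M₁s)) = E₂.σ (β' x : M₂s) := by
  obtain ⟨⟨hbr, ha⟩, hM, -, -, hact⟩ := hiso
  simp only [LinearEquiv.coe_coe] at hbr ha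
  have key : ∀ (x : M₁s) (hx : x ∈ E₁.comm), γ (E₁.σ x) = E₂.σ (β' ⟨x, hx⟩ : M₂s) := by
    intro x hx
    refine Submodule.span_induction
      (p := fun x hx => γ (E₁.σ x) = E₂.σ (β' ⟨x, hx⟩ : M₂s)) ?_ ?_ ?_ ?_ hx
    · rintro x ⟨l, m, rfl⟩
      have h2 : γ (E₁.σ m) ∈ LinearMap.range E₂.σ := by
        rw [E₂.range_σ, ← hM]
        refine Submodule.mem_map_of_mem (f := γ.toLinearMap) ?_
        exact E₁.range_σ.le (LinearMap.mem_range_self _ _)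
      obtain ⟨m₂, hm₂⟩ := h2
      have hσ : γ (E₁.σ (E₁.HM.a m)) = E₂.σ (E₂.HM.a m₂) := by
        rw [E₁.σ_a, ha, E₂.σ_a, hm₂]
      have hmem : E₁.act l (E₁.HM.a m) ∈ E₁.comm := Submodule.subset_span ⟨l, m, rfl⟩
      change γ (E₁.σ (E₁.act l (E₁.HM.a m))) = E₂.σ (β' ⟨E₁.act l (E₁.HM.a m), hmem⟩ : M₂s)
      rw [hact l m (γ l) m₂ hσ (ha l) hmem, E₁.σ_act, E₂.σ_act, hbr, hσ, ha]
    · change γ (E₁.σ 0) = E₂.σ (β' (0 : E₁.comm) : M₂s)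
      simp
    · intro x y hx hy h1 h2
      change γ (E₁.σ (x + y)) = E₂.σ (β' ((⟨x, hx⟩ : E₁.comm) + ⟨y, hy⟩) : M₂s)
      rw [map_add β', Submodule.coe_add, map_add, map_add, map_add, h1, h2]
    · intro c x hx h1
      change γ (E₁.σ (c • x)) = E₂.σ (β' (c • (⟨x, hx⟩ : E₁.comm)) : M₂s)
      rw [map_smul β', Submodule.coe_smul, map_smul, map_smul, map_smul, h1]
  exact fun x => key x x.2
end

section
/- Let σ₁:(M₁*,α₁*)→(L₁,α₁) and σ₂:(M₂*,α₂*)→(L₂,α₂) be relative central extensions of the pairs of regular Hom-Lie algebras (M₁,L₁) and (M₂,L₂), respectively. If (γ,β') is an isoclinism from σ₁ to σ₂, then β'(Ker σ₁ ∩ [M₁*,L₁]) = Ker σ₂ ∩ [M₂*,L₂]. -/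
/-- Lemma 2.3(2): if (γ,β') is an isoclinism from σ₁ to σ₂, then
β'(Ker σ₁ ∩ [M₁*,L₁]) = Ker σ₂ ∩ [M₂*,L₂]. -/
theorem stmt_1 {K L₁ L₂ M₁s M₂s : Type} [Field K]
    [AddCommGroup L₁] [Module K L₁] [AddCommGroup L₂] [Module K L₂]
    [AddCommGroup M₁s] [Module K M₁s] [AddCommGroup M₂s] [Module K M₂s]
    {HL₁ : HomLie K L₁} {HL₂ : HomLie K L₂}
    {M₁ : Submodule K L₁} {M₂ : Submodule K L₂}
    (hreg₁ : HL₁.IsRegular) (hid₁ : HL₁.IsIdeal M₁)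
    (hreg₂ : HL₂.IsRegular) (hid₂ : HL₂.IsIdeal M₂)
    (E₁ : RelCentExt K L₁ M₁s HL₁ M₁) (E₂ : RelCentExt K L₂ M₂s HL₂ M₂)
    (γ : L₁ ≃ₗ[K] L₂) (β' : ↥E₁.comm ≃ₗ[K] ↥E₂.comm)
    (hiso : IsIsoclinism E₁ E₂ γ β') :
    (fun x : E₁.comm => (β' x : M₂s)) '' {x : E₁.comm | (x : M₁s) ∈ LinearMap.ker E₁.σ}
      = ↑(LinearMap.ker E₂.σ ⊓ E₂.comm) := by
  obtain ⟨⟨hbr, ha⟩, hM, -, -, hact⟩ := hiso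
  simp only [LinearEquiv.coe_coe] at hbr ha
  have key : ∀ (x : M₁s) (hx : x ∈ E₁.comm), γ (E₁.σ x) = E₂.σ (β' ⟨x, hx⟩ : M₂s) := by
    intro x hx
    induction hx using Submodule.span_induction with
    | mem x h =>
      obtain ⟨l, m, rfl⟩ := h
      have hmem : γ (E₁.σ m) ∈ LinearMap.range E₂.σ := by
        rw [E₂.range_σ, ← hM]
        exact ⟨E₁.σ m, E₁.range_σ.le ⟨m, rfl⟩, rfl⟩
      obtain ⟨m₂, hm₂⟩ := hmem
      have h1 : γ (E₁.σ (E₁.HM.a m)) = E₂.σ (E₂.HM.a m₂) := by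
        rw [E₁.σ_a, E₂.σ_a, ha, hm₂]
      have hc : E₁.act l (E₁.HM.a m) ∈ E₁.comm := Submodule.subset_span ⟨l, m, rfl⟩
      refine Eq.trans ?_ (congrArg E₂.σ (hact l m (γ l) m₂ h1 (ha l) hc)).symm
      rw [E₁.σ_act, E₂.σ_act, hbr, h1, ha]
    | zero =>
      have h0 : (⟨0, E₁.comm.zero_mem⟩ : E₁.comm) = 0 := rfl
      erw [h0]
      simp
    | add x y hx hy ihx ihy =>
      have h0 : (⟨x + y, E₁.comm.add_mem hx hy⟩ : E₁.comm) = ⟨x, hx⟩ + ⟨y, hy⟩ := rfl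
      erw [h0]
      rw [map_add, map_add, map_add, Submodule.coe_add, map_add, ihx, ihy]
    | smul c x hx ih =>
      have h0 : (⟨c • x, E₁.comm.smul_mem c hx⟩ : E₁.comm) = c • ⟨x, hx⟩ := rfl
      erw [h0]
      rw [map_smul, map_smul, map_smul, Submodule.coe_smul, map_smul, ih]
  ext y
  constructor
  · rintro ⟨x, hx, rfl⟩
    refine ⟨?_, (β' x).2⟩
    have h := key x x.2
    have hx' : E₁.σ (x : M₁s) = 0 := hx
    rw [hx', map_zero] at h
    exact h.symm
  · rintro ⟨hy, hyc⟩
    refine ⟨β'.symm ⟨y, hyc⟩, ?_, by simp⟩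
    have h := key (β'.symm ⟨y, hyc⟩) (β'.symm ⟨y, hyc⟩).2
    have hy' : E₂.σ y = 0 := hy
    rw [Subtype.coe_eta, LinearEquiv.apply_symm_apply, hy'] at h
    exact γ.map_eq_zero_iff.mp h
end

section
/- Let σ₁:(M₁*,α₁*)→(L₁,α₁) and σ₂:(M₂*,α₂*)→(L₂,α₂) be relative central extensions of the pairs of regular Hom-Lie algebras (M₁,L₁) and (M₂,L₂), respectively. If (γ,β') is an isoclinism from σ₁ to σ₂, then β'(^{l₁}x) = ^{l₂}β'(x) for all x ∈ [M₁*,L₁] and all l₁ ∈ L₁, l₂ ∈ L₂ with γα₁(l₁) = α₂(l₂). -/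
/-- Lemma 2.3(3): if (γ,β') is an isoclinism from σ₁ to σ₂, then
β'(^{l₁} x) = ^{l₂} (β' x) for all x ∈ [M₁*,L₁] and l₁ ∈ L₁, l₂ ∈ L₂ with
γ(α₁ l₁) = α₂ l₂. -/
theorem stmt_2 {K L₁ L₂ M₁s M₂s : Type} [Field K]
    [AddCommGroup L₁] [Module K L₁] [AddCommGroup L₂] [Module K L₂]
    [AddCommGroup M₁s] [Module K M₁s] [AddCommGroup M₂s] [Module K M₂s]
    {HL₁ : HomLie K L₁} {HL₂ : HomLie K L₂}
    {M₁ : Submodule K L₁} {M₂ : Submodule K L₂}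
    (hreg₁ : HL₁.IsRegular) (hid₁ : HL₁.IsIdeal M₁)
    (hreg₂ : HL₂.IsRegular) (hid₂ : HL₂.IsIdeal M₂)
    (E₁ : RelCentExt K L₁ M₁s HL₁ M₁) (E₂ : RelCentExt K L₂ M₂s HL₂ M₂)
    (γ : L₁ ≃ₗ[K] L₂) (β' : ↥E₁.comm ≃ₗ[K] ↥E₂.comm)
    (hiso : IsIsoclinism E₁ E₂ γ β') :
    ∀ (x : E₁.comm) (l₁ : L₁) (l₂ : L₂), γ (HL₁.a l₁) = HL₂.a l₂ →
      ∀ h : E₁.act l₁ (x : M₁s) ∈ E₁.comm,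
        (β' ⟨E₁.act l₁ (x : M₁s), h⟩ : M₂s) = E₂.act l₂ (β' x : M₂s) := by
  obtain ⟨hγ, hM, -, -, hβ⟩ := hiso
  have key : ∀ (x : M₁s) (hx : x ∈ E₁.comm), ∃ n n₂, x = E₁.HM.a n ∧
      (β' ⟨x, hx⟩ : M₂s) = E₂.HM.a n₂ ∧ γ (E₁.σ x) = E₂.σ (β' ⟨x, hx⟩ : M₂s) := by
    intro x hx
    refine Submodule.span_induction (p := fun x (hx : x ∈ E₁.comm) => ∃ n n₂, x = E₁.HM.a n ∧
      (β' ⟨x, hx⟩ : M₂s) = E₂.HM.a n₂ ∧ γ (E₁.σ x) = E₂.σ (β' ⟨x, hx⟩ : M₂s))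
      ?_ ?_ ?_ ?_ hx
    · rintro x ⟨l, m, rfl⟩
      obtain ⟨l', rfl⟩ := hreg₁.2.2 l
      have hm : γ (E₁.σ m) ∈ M₂ := by
        rw [← hM]
        refine Submodule.mem_map_of_mem (f := γ.toLinearMap) ?_
        exact E₁.range_σ.le (LinearMap.mem_range_self _ _)
      rw [← E₂.range_σ] at hm
      obtain ⟨m₂, hm₂⟩ := hm
      have ha : ∀ y, γ (HL₁.a y) = HL₂.a (γ y) := hγ.2
      have hb : ∀ y z, γ (HL₁.br y z) = HL₂.br (γ y) (γ z) := hγ.1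
      have e : γ (E₁.σ (E₁.HM.a m)) = E₂.σ (E₂.HM.a m₂) := by
        rw [E₁.σ_a, E₂.σ_a, ha, hm₂]
      have h1 := hβ (HL₁.a l') m (HL₂.a (γ l')) m₂ e (by rw [ha, ha])
        (Submodule.subset_span ⟨_, _, rfl⟩)
      refine ⟨E₁.act l' m, E₂.act (γ l') m₂, (E₁.act_a _ _).symm, ?_, ?_⟩
      · rw [E₂.act_a]; exact h1
      · refine Eq.trans ?_ (congrArg E₂.σ h1.symm)
        rw [E₁.σ_act, E₂.σ_act, hb, e, ha, ha]
    · have h0 : (β' ⟨0, E₁.comm.zero_mem⟩ : M₂s) = 0 := congrArg Subtype.val (map_zero β')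
      exact ⟨0, 0, by simp, by rw [map_zero]; exact h0,
        by rw [map_zero, map_zero]; exact ((congrArg E₂.σ h0).trans (map_zero _)).symm⟩
    · rintro x y hx hy ⟨n, n₂, h1, h2, h3⟩ ⟨k, k₂, g1, g2, g3⟩
      have h0 : (β' ⟨x + y, E₁.comm.add_mem hx hy⟩ : M₂s) = β' ⟨x, hx⟩ + β' ⟨y, hy⟩ :=
        congrArg Subtype.val (map_add β' ⟨x, hx⟩ ⟨y, hy⟩)
      refine ⟨n + k, n₂ + k₂, by rw [map_add, h1, g1], ?_, ?_⟩
      · rw [map_add, ← h2, ← g2]; exact h0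
      · refine Eq.trans ?_ (congrArg E₂.σ h0.symm)
        rw [map_add, map_add, map_add, h3, g3]
    · rintro c x hx ⟨n, n₂, h1, h2, h3⟩
      have h0 : (β' ⟨c • x, E₁.comm.smul_mem c hx⟩ : M₂s) = c • (β' ⟨x, hx⟩ : M₂s) :=
        congrArg Subtype.val (map_smul β' c ⟨x, hx⟩)
      refine ⟨c • n, c • n₂, by rw [map_smul, h1], ?_, ?_⟩
      · rw [map_smul, ← h2]; exact h0
      · refine Eq.trans ?_ (congrArg E₂.σ h0.symm)
        rw [map_smul, map_smul, map_smul, h3]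
  rintro ⟨x, hx⟩ l₁ l₂ hl h
  obtain ⟨n, n₂, h1, h2, h3⟩ := key x hx
  rw [h2] at h3 ⊢
  subst h1
  exact hβ l₁ n l₂ n₂ h3 hl h
end

section
/- Let σ₁:(M₁*,α₁*)→(L₁,α₁) and σ₂:(M₂*,α₂*)→(L₂,α₂) be relative central extensions of the pairs of regular Hom-Lie algebras (M₁,L₁) and (M₂,L₂), and let γ:(L₁,α₁)→(L₂,α₂) be a Hom-Lie isomorphism with γ(M₁)=M₂. Then M̄* = {(m₁,m₂) : m₁∈M₁*, m₂∈M₂*, γσ₁(α₁*(m₁))=σ₂(α₂*(m₂))} is a Hom-Lie subalgebra of M₁*×M₂*, and the homomorphism σ̂: M̄* → L₁, (m₁,m₂) ↦ σ₁(m₁), together with the action of L₁ on M̄* defined by ^{l₁}(m₁,m₂) = (^{l₁}m₁, ^{l₂}m₂) where γα₁(l₁)=α₂(l₂), is a relative central extension of the pair (M₁,L₁). -/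
/-- given a Hom-Lie isomorphism γ : L₁ → L₂ with γ(M₁) = M₂, the set
M̄* = {(m₁,m₂) : γσ₁(α₁ m₁) = σ₂(α₂ m₂)} is a Hom-Lie subalgebra of M₁* × M₂*, and
σ̂ : M̄* → L₁, (m₁,m₂) ↦ σ₁ m₁, with the action ^{l₁}(m₁,m₂) = (^{l₁}m₁, ^{l₂}m₂)
(where γ(α₁ l₁) = α₂ l₂), is a relative central extension of the pair (M₁, L₁). -/
theorem stmt_3 {K L₁ L₂ M₁s M₂s : Type} [Field K]
    [AddCommGroup L₁] [Module K L₁] [AddCommGroup L₂] [Module K L₂]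
    [AddCommGroup M₁s] [Module K M₁s] [AddCommGroup M₂s] [Module K M₂s]
    {HL₁ : HomLie K L₁} {HL₂ : HomLie K L₂}
    {M₁ : Submodule K L₁} {M₂ : Submodule K L₂}
    (hreg₁ : HL₁.IsRegular) (hid₁ : HL₁.IsIdeal M₁)
    (hreg₂ : HL₂.IsRegular) (hid₂ : HL₂.IsIdeal M₂)
    (E₁ : RelCentExt K L₁ M₁s HL₁ M₁) (E₂ : RelCentExt K L₂ M₂s HL₂ M₂)
    (γ : L₁ ≃ₗ[K] L₂) (hγ : IsHomLieHom HL₁ HL₂ γ.toLinearMap)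
    (hγM : M₁.map γ.toLinearMap = M₂) :
    (∀ p q : M₁s × M₂s, p ∈ MbarSub E₁ E₂ γ.toLinearMap → q ∈ MbarSub E₁ E₂ γ.toLinearMap →
        (E₁.HM.br p.1 q.1, E₂.HM.br p.2 q.2) ∈ MbarSub E₁ E₂ γ.toLinearMap ∧
        (E₁.HM.a p.1, E₂.HM.a p.2) ∈ MbarSub E₁ E₂ γ.toLinearMap) ∧
    ∃ Ehat : RelCentExt K L₁ (↥(MbarSub E₁ E₂ γ.toLinearMap)) HL₁ M₁,
      (∀ p q : ↥(MbarSub E₁ E₂ γ.toLinearMap),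
          (Ehat.HM.br p q : M₁s × M₂s)
            = (E₁.HM.br (p : M₁s × M₂s).1 (q : M₁s × M₂s).1,
               E₂.HM.br (p : M₁s × M₂s).2 (q : M₁s × M₂s).2)) ∧
      (∀ p : ↥(MbarSub E₁ E₂ γ.toLinearMap),
          (Ehat.HM.a p : M₁s × M₂s)
            = (E₁.HM.a (p : M₁s × M₂s).1, E₂.HM.a (p : M₁s × M₂s).2)) ∧
      (∀ p : ↥(MbarSub E₁ E₂ γ.toLinearMap), Ehat.σ p = E₁.σ (p : M₁s × M₂s).1) ∧
      (∀ (l₁ : L₁) (l₂ : L₂), γ (HL₁.a l₁) = HL₂.a l₂ →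
        ∀ p : ↥(MbarSub E₁ E₂ γ.toLinearMap),
          (Ehat.act l₁ p : M₁s × M₂s)
            = (E₁.act l₁ (p : M₁s × M₂s).1, E₂.act l₂ (p : M₁s × M₂s).2)) := by
  have ha : ∀ x, γ (HL₁.a x) = HL₂.a (γ x) := hγ.2
  have hb : ∀ x y, γ (HL₁.br x y) = HL₂.br (γ x) (γ y) := hγ.1
  have hmem : ∀ p : M₁s × M₂s, p ∈ MbarSub E₁ E₂ γ.toLinearMap ↔ γ (E₁.σ p.1) = E₂.σ p.2 := by
    intro p
    simp only [MbarSub, LinearMap.mem_ker, LinearMap.sub_apply, LinearMap.comp_apply,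
      LinearMap.fst_apply, LinearMap.snd_apply, sub_eq_zero, LinearEquiv.coe_coe]
    rw [E₁.σ_a, E₂.σ_a, ha]
    exact hreg₂.2.1.eq_iff
  have hbr : ∀ p q : M₁s × M₂s, p ∈ MbarSub E₁ E₂ γ.toLinearMap →
      q ∈ MbarSub E₁ E₂ γ.toLinearMap →
      (E₁.HM.br p.1 q.1, E₂.HM.br p.2 q.2) ∈ MbarSub E₁ E₂ γ.toLinearMap := by
    intro p q hp hq
    rw [hmem] at hp hq ⊢
    simp only [E₁.σ_br, E₂.σ_br, hb, hp, hq]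
  have hal : ∀ p : M₁s × M₂s, p ∈ MbarSub E₁ E₂ γ.toLinearMap →
      (E₁.HM.a p.1, E₂.HM.a p.2) ∈ MbarSub E₁ E₂ γ.toLinearMap := by
    intro p hp
    rw [hmem] at hp ⊢
    simp only [E₁.σ_a, E₂.σ_a, ha, hp]
  have hact : ∀ (l : L₁) (p : M₁s × M₂s), p ∈ MbarSub E₁ E₂ γ.toLinearMap →
      (E₁.act l p.1, E₂.act (γ l) p.2) ∈ MbarSub E₁ E₂ γ.toLinearMap := by
    intro l p hp
    rw [hmem] at hp ⊢
    apply hreg₂.2.1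
    simp only
    rw [← ha, ← E₁.σ_a, ← E₂.σ_a, E₁.act_a, E₂.act_a, E₁.σ_act, E₂.σ_act, hb, ha, ha,
      E₁.σ_a, E₂.σ_a, ha, hp]
  refine ⟨fun p q hp hq => ⟨hbr p q hp hq, hal p hp⟩, ?_⟩
  let H : HomLie K (MbarSub E₁ E₂ γ.toLinearMap) :=
    { br := LinearMap.mk₂ K (fun p q => ⟨_, hbr p.1 q.1 p.2 q.2⟩)
        (by intros; ext <;> simp) (by intros; ext <;> simp)
        (by intros; ext <;> simp) (by intros; ext <;> simp)
      a :=
        { toFun := fun p => ⟨_, hal p.1 p.2⟩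
          map_add' := by intros; ext <;> simp
          map_smul' := by intros; ext <;> simp }
      skew := by
        intro x y
        ext
        · exact E₁.HM.skew _ _
        · exact E₂.HM.skew _ _
      jacobi := by
        intro x y z
        ext
        · exact E₁.HM.jacobi _ _ _
        · exact E₂.HM.jacobi _ _ _ }
  let A : L₁ →ₗ[K] MbarSub E₁ E₂ γ.toLinearMap →ₗ[K] MbarSub E₁ E₂ γ.toLinearMap :=
    LinearMap.mk₂ K (fun l q => ⟨_, hact l q.1 q.2⟩)
        (by intros; ext <;> simp) (by intros; ext <;> simp)
        (by intros; ext <;> simp) (by intros; ext <;> simp)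
  refine ⟨{ HM := H
            σ := E₁.σ ∘ₗ LinearMap.fst K M₁s M₂s ∘ₗ (MbarSub E₁ E₂ γ.toLinearMap).subtype
            σ_br := fun m m' => E₁.σ_br _ _
            σ_a := fun m => E₁.σ_a _
            act := A
            act_jac := ?_
            act_brk := ?_
            act_a := ?_
            range_σ := ?_
            σ_act := fun l m => E₁.σ_act _ _
            act_self := ?_ }, fun p q => rfl, fun p => rfl, fun p => rfl, ?_⟩
  · intro x y k
    ext
    · exact E₁.act_jac _ _ _
    · change E₂.act (γ (HL₁.br x y)) (E₂.HM.a k.1.2) = E₂.act (γ (HL₁.a x)) (E₂.act (γ y) k.1.2)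
        - E₂.act (γ (HL₁.a y)) (E₂.act (γ x) k.1.2)
      rw [hb, ha, ha, E₂.act_jac]
  · intro x k k'
    ext
    · exact E₁.act_brk _ _ _
    · change E₂.act (γ (HL₁.a x)) (E₂.HM.br k.1.2 k'.1.2) =
        E₂.HM.br (E₂.act (γ x) k.1.2) (E₂.HM.a k'.1.2)
          + E₂.HM.br (E₂.HM.a k.1.2) (E₂.act (γ x) k'.1.2)
      rw [ha, E₂.act_brk]
  · intro x k
    ext
    · exact E₁.act_a _ _
    · change E₂.HM.a (E₂.act (γ x) k.1.2) = E₂.act (γ (HL₁.a x)) (E₂.HM.a k.1.2)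
      rw [ha, E₂.act_a]
  · apply le_antisymm
    · rintro _ ⟨p, rfl⟩
      exact E₁.range_σ.le ⟨p.1.1, rfl⟩
    · intro m hm
      have h2 : γ m ∈ M₂ := hγM ▸ Submodule.mem_map_of_mem (f := γ.toLinearMap) hm
      rw [← E₁.range_σ] at hm
      rw [← E₂.range_σ] at h2
      obtain ⟨m₁, rfl⟩ := hm
      obtain ⟨m₂, h2⟩ := h2
      exact ⟨⟨(m₁, m₂), (hmem _).2 h2.symm⟩, rfl⟩
  · intro m m'
    ext
    · exact E₁.act_self _ _
    · change E₂.act (γ (E₁.σ m'.1.1)) (E₂.HM.a m.1.2) = E₂.HM.br m'.1.2 m.1.2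
      rw [(hmem _).1 m'.2, E₂.act_self]
  · intro l₁ l₂ h p
    rw [ha] at h
    rw [← hreg₂.2.1 h]
    rfl
end

section
/- Let σ₁:(M₁*,α₁*)→(L₁,α₁) and σ₂:(M₂*,α₂*)→(L₂,α₂) be relative central extensions of the pairs of regular Hom-Lie algebras (M₁,L₁) and (M₂,L₂), and let (γ,β') be an isoclinism from σ₁ to σ₂. Let σ̂: M̄*→L₁ be the relative central extension with M̄* = {(m₁,m₂) : γσ₁(α₁*(m₁))=σ₂(α₂*(m₂))}, σ̂(m₁,m₂)=σ₁(m₁), and let A = M̄*/[M̄*,L₁]. Then there exist isoclinic monomorphisms from σ̂ into σ₁π_{M₁*}: M₁*×A → L₁ and from σ̂ into σ₂π_{M₂*}: M₂*×A → L₂. -/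
/-- An isoclinic morphism `(γ, f)` becomes an isoclinic monomorphism after adding the
quotient map onto the abelianization. -/
theorem mono_of_morphism {K L₁ L₂ M₁s M₂s : Type} [Field K]
    [AddCommGroup L₁] [Module K L₁] [AddCommGroup L₂] [Module K L₂]
    [AddCommGroup M₁s] [Module K M₁s] [AddCommGroup M₂s] [Module K M₂s]
    {HL₁ : HomLie K L₁} {HL₂ : HomLie K L₂}
    {M₁ : Submodule K L₁} {M₂ : Submodule K L₂}
    (E : RelCentExt K L₁ M₁s HL₁ M₁) (E' : RelCentExt K L₂ M₂s HL₂ M₂)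
    (γ : L₁ →ₗ[K] L₂) (f : M₁s →ₗ[K] M₂s)
    (hf : IsIsoclinicMorphism E E' γ f)
    (HA : HomLie K (M₁s ⧸ E.comm)) (hAab : HA.IsAbelian)
    (hAa : ∀ m, HA.a (Submodule.Quotient.mk m) = Submodule.Quotient.mk (E.HM.a m))
    (P : RelCentExt K L₂ (M₂s × (M₁s ⧸ E.comm)) HL₂ M₂) (hP : IsProdExt E' HA P) :
    IsIsoclinicMono E P γ (f.prod E.comm.mkQ) := by
  obtain ⟨⟨hγ, hM, ⟨hbr, ha⟩, hcomm, hσ⟩, hbij, hinj, hcompat⟩ := hf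
  obtain ⟨Pbr, Pa, Pσ, Pact⟩ := hP
  have hi : Function.Injective (f.prod E.comm.mkQ) := by
    rw [injective_iff_map_eq_zero]
    intro x hx
    have h1 : f x = 0 := congrArg Prod.fst hx
    have h2 : E.comm.mkQ x = 0 := congrArg Prod.snd hx
    have h3 : x ∈ E.comm := by simpa using h2
    exact hinj h3 E.comm.zero_mem (by simpa using h1)
  have hmem : ∀ l m, E.act l (E.HM.a m) ∈ E.comm := fun l m =>
    Submodule.subset_span ⟨l, m, rfl⟩
  have hPc : P.comm = E'.comm.map (LinearMap.inl K M₂s (M₁s ⧸ E.comm)) := by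
    have hE' : E'.comm = Submodule.span K {x | ∃ l m, x = E'.act l (E'.HM.a m)} := rfl
    have hPc' : P.comm = Submodule.span K {x | ∃ l m, x = P.act l (P.HM.a m)} := rfl
    rw [hE', hPc', Submodule.map_span]
    congr 1
    ext x
    constructor
    · rintro ⟨l, m, rfl⟩
      exact ⟨_, ⟨l, m.1, rfl⟩, by rw [Pact, Pa]; rfl⟩
    · rintro ⟨_, ⟨l, m, rfl⟩, rfl⟩
      exact ⟨l, (m, 0), by rw [Pact, Pa]; rfl⟩
  refine ⟨⟨⟨hγ, hM, ⟨?_, ?_⟩, ?_, ?_⟩, hbij, hi.injOn, ?_⟩, hi⟩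
  · intro x y
    rw [Pbr, hAab]
    refine Prod.ext (hbr x y) ?_
    have : E.HM.br x y ∈ E.comm := by
      rw [← E.act_self]; exact hmem _ _
    simpa using this
  · intro x
    rw [Pa]
    exact Prod.ext (ha x) (hAa x).symm
  · rw [hPc, ← hcomm, ← Submodule.map_comp]
    apply SetLike.coe_injective
    rw [Submodule.map_coe, Submodule.map_coe]
    apply Set.image_congr
    intro x hx
    refine Prod.ext rfl ?_
    simpa using hx
  · intro m
    rw [Pσ]; exact hσ m
  · intro l₁ m₁ l₂ m₂ h1 h2
    rw [Pσ, Pa] at h1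
    rw [Pact, Pa]
    refine Prod.ext (hcompat l₁ m₁ l₂ m₂.1 h1 h2) ?_
    simpa using hmem l₁ m₁

/-- Proposition 2.5: let (γ,β') be an isoclinism from σ₁ to σ₂ and let
A = M̄*/[M̄*,L₁] (an abelian Hom-Lie algebra with twist induced by that of M̄*).
Then there exist isoclinic monomorphisms from σ̂ into σ₁π_{M₁*} : M₁* × A → L₁ and
into σ₂π_{M₂*} : M₂* × A → L₂. -/
theorem stmt_5 {K L₁ L₂ M₁s M₂s : Type} [Field K]
    [AddCommGroup L₁] [Module K L₁] [AddCommGroup L₂] [Module K L₂]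
    [AddCommGroup M₁s] [Module K M₁s] [AddCommGroup M₂s] [Module K M₂s]
    {HL₁ : HomLie K L₁} {HL₂ : HomLie K L₂}
    {M₁ : Submodule K L₁} {M₂ : Submodule K L₂}
    (hreg₁ : HL₁.IsRegular) (hid₁ : HL₁.IsIdeal M₁)
    (hreg₂ : HL₂.IsRegular) (hid₂ : HL₂.IsIdeal M₂)
    (E₁ : RelCentExt K L₁ M₁s HL₁ M₁) (E₂ : RelCentExt K L₂ M₂s HL₂ M₂)
    (γ : L₁ ≃ₗ[K] L₂) (β' : ↥E₁.comm ≃ₗ[K] ↥E₂.comm)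
    (hiso : IsIsoclinism E₁ E₂ γ β')
    (Ehat : RelCentExt K L₁ (↥(MbarSub E₁ E₂ γ.toLinearMap)) HL₁ M₁)
    (hEbr : ∀ p q : ↥(MbarSub E₁ E₂ γ.toLinearMap),
        (Ehat.HM.br p q : M₁s × M₂s)
          = (E₁.HM.br (p : M₁s × M₂s).1 (q : M₁s × M₂s).1,
             E₂.HM.br (p : M₁s × M₂s).2 (q : M₁s × M₂s).2))
    (hEa : ∀ p : ↥(MbarSub E₁ E₂ γ.toLinearMap),
        (Ehat.HM.a p : M₁s × M₂s)
          = (E₁.HM.a (p : M₁s × M₂s).1, E₂.HM.a (p : M₁s × M₂s).2))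
    (hEσ : ∀ p : ↥(MbarSub E₁ E₂ γ.toLinearMap), Ehat.σ p = E₁.σ (p : M₁s × M₂s).1)
    (hEact : ∀ (l₁ : L₁) (l₂ : L₂), γ (HL₁.a l₁) = HL₂.a l₂ →
      ∀ p : ↥(MbarSub E₁ E₂ γ.toLinearMap),
        (Ehat.act l₁ p : M₁s × M₂s)
          = (E₁.act l₁ (p : M₁s × M₂s).1, E₂.act l₂ (p : M₁s × M₂s).2))
    (HA : HomLie K (↥(MbarSub E₁ E₂ γ.toLinearMap) ⧸ Ehat.comm))
    (hAab : HA.IsAbelian)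
    (hAa : ∀ m : ↥(MbarSub E₁ E₂ γ.toLinearMap),
        HA.a (Submodule.Quotient.mk m) = Submodule.Quotient.mk (Ehat.HM.a m))
    (P₁ : RelCentExt K L₁ (M₁s × (↥(MbarSub E₁ E₂ γ.toLinearMap) ⧸ Ehat.comm)) HL₁ M₁)
    (hP₁ : IsProdExt E₁ HA P₁)
    (P₂ : RelCentExt K L₂ (M₂s × (↥(MbarSub E₁ E₂ γ.toLinearMap) ⧸ Ehat.comm)) HL₂ M₂)
    (hP₂ : IsProdExt E₂ HA P₂) :
    (∃ (γ₁ : L₁ →ₗ[K] L₁)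
       (β₁ : ↥(MbarSub E₁ E₂ γ.toLinearMap) →ₗ[K]
         (M₁s × (↥(MbarSub E₁ E₂ γ.toLinearMap) ⧸ Ehat.comm))),
        IsIsoclinicMono Ehat P₁ γ₁ β₁) ∧
    (∃ (γ₂ : L₁ →ₗ[K] L₂)
       (β₂ : ↥(MbarSub E₁ E₂ γ.toLinearMap) →ₗ[K]
         (M₂s × (↥(MbarSub E₁ E₂ γ.toLinearMap) ⧸ Ehat.comm))),
        IsIsoclinicMono Ehat P₂ γ₂ β₂) := by
  obtain ⟨hγ, hM, -, -, hβ⟩ := hiso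
  have hγa : ∀ x, γ (HL₁.a x) = HL₂.a (γ x) := hγ.2
  have hmem₁ : ∀ l m, E₁.act l (E₁.HM.a m) ∈ E₁.comm := fun l m =>
    Submodule.subset_span ⟨l, m, rfl⟩
  have hbar : ∀ m₁ m₂, (m₁, m₂) ∈ MbarSub E₁ E₂ γ.toLinearMap ↔ γ (E₁.σ m₁) = E₂.σ m₂ := by
    intro m₁ m₂
    have : (m₁, m₂) ∈ MbarSub E₁ E₂ γ.toLinearMap ↔
        γ (E₁.σ (E₁.HM.a m₁)) = E₂.σ (E₂.HM.a m₂) := by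
      simp [MbarSub, sub_eq_zero]
    rw [this, E₁.σ_a, E₂.σ_a, hγa]
    exact hreg₂.2.1.eq_iff
  have hbar' : ∀ p : ↥(MbarSub E₁ E₂ γ.toLinearMap), γ (E₁.σ p.1.1) = E₂.σ p.1.2 :=
    fun p => (hbar _ _).1 p.2
  have hact : ∀ l p, (Ehat.act l (Ehat.HM.a p) : M₁s × M₂s)
      = (E₁.act l (E₁.HM.a p.1.1), E₂.act (γ l) (E₂.HM.a p.1.2)) := by
    intro l p
    rw [hEact l (γ l) (hγa l), hEa]
  -- the commutator of the pullback is the graph of the isoclinism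
  have hgraph : ∀ x ∈ Ehat.comm, ∃ h : x.1.1 ∈ E₁.comm, (β' ⟨x.1.1, h⟩ : M₂s) = x.1.2 := by
    intro x hx
    induction hx using Submodule.span_induction with
    | mem x hx =>
      obtain ⟨l, m, rfl⟩ := hx
      rw [hact]
      refine ⟨hmem₁ _ _, ?_⟩
      exact hβ l m.1.1 (γ l) m.1.2 (by rw [E₁.σ_a, E₂.σ_a, hγa, hbar']) (hγa l) _
    | zero => exact ⟨E₁.comm.zero_mem, congrArg Subtype.val (map_zero β')⟩
    | add x y _ _ hx hy =>
      obtain ⟨h1, e1⟩ := hx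
      obtain ⟨h2, e2⟩ := hy
      refine ⟨E₁.comm.add_mem h1 h2, ?_⟩
      have := congrArg Subtype.val (map_add β' ⟨_, h1⟩ ⟨_, h2⟩)
      refine this.trans ?_
      rw [Submodule.coe_add, e1, e2]; rfl
    | smul c x _ hx =>
      obtain ⟨h1, e1⟩ := hx
      refine ⟨E₁.comm.smul_mem c h1, ?_⟩
      have := congrArg Subtype.val (map_smul β' c ⟨_, h1⟩)
      refine this.trans ?_
      rw [Submodule.coe_smul, e1]; rfl
  refine ⟨⟨LinearMap.id, _, mono_of_morphism Ehat E₁ LinearMap.id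
      (LinearMap.fst K M₁s M₂s ∘ₗ Submodule.subtype _) ?_ HA hAab hAa P₁ hP₁⟩,
    ⟨γ.toLinearMap, _, mono_of_morphism Ehat E₂ γ.toLinearMap
      (LinearMap.snd K M₁s M₂s ∘ₗ Submodule.subtype _) ?_ HA hAab hAa P₂ hP₂⟩⟩
  · refine ⟨⟨⟨fun _ _ => rfl, fun _ => rfl⟩, Submodule.map_id _,
      ⟨fun x y => congrArg Prod.fst (hEbr x y), fun x => congrArg Prod.fst (hEa x)⟩,
      ?_, fun m => hEσ m⟩, Function.bijective_id, ?_, ?_⟩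
    · unfold RelCentExt.comm
      rw [Submodule.map_span]
      congr 1
      ext x
      constructor
      · rintro ⟨_, ⟨l, m, rfl⟩, rfl⟩
        exact ⟨l, m.1.1, congrArg Prod.fst (hact l m)⟩
      · rintro ⟨l, m, rfl⟩
        have h : γ (E₁.σ m) ∈ M₂ := by
          exact hM.le ⟨_, E₁.range_σ.le ⟨m, rfl⟩, rfl⟩
        obtain ⟨m₂, h⟩ := E₂.range_σ.ge h
        exact ⟨_, ⟨l, ⟨(m, m₂), (hbar _ _).2 h.symm⟩, rfl⟩, congrArg Prod.fst (hact l _)⟩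
    · intro x hx y hy hxy
      obtain ⟨h1, e1⟩ := hgraph x hx
      obtain ⟨h2, e2⟩ := hgraph y hy
      have hxy' : x.1.1 = y.1.1 := hxy
      refine Subtype.ext (Prod.ext hxy' ?_)
      rw [← e1, ← e2]
      congr 3
    · intro l₁ m₁ l₂ m₂ h1 h2
      have hl : l₁ = l₂ := hreg₁.2.1 h2
      subst hl
      have e1 : γ (E₁.σ (E₁.HM.a m₁.1.1)) = E₂.σ (E₂.HM.a m₁.1.2) := by
        rw [E₁.σ_a, E₂.σ_a, hγa, hbar']
      have h1' : E₁.σ (E₁.HM.a m₁.1.1) = E₁.σ (E₁.HM.a m₂) := by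
        have : Ehat.σ (Ehat.HM.a m₁) = E₁.σ (E₁.HM.a m₂) := h1
        rw [hEσ, hEa] at this
        exact this
      have e2 := e1
      rw [h1'] at e2
      have q1 := hβ l₁ _ _ _ e1 (hγa l₁) (hmem₁ _ _)
      have q2 := hβ l₁ _ _ _ e2 (hγa l₁) (hmem₁ _ _)
      have q := congrArg Subtype.val (β'.injective (Subtype.ext (q1.trans q2.symm)))
      exact (congrArg Prod.fst (hact l₁ m₁)).trans q
  · refine ⟨⟨hγ, hM,
      ⟨fun x y => congrArg Prod.snd (hEbr x y), fun x => congrArg Prod.snd (hEa x)⟩,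
      ?_, fun m => ?_⟩, γ.bijective, ?_, ?_⟩
    · unfold RelCentExt.comm
      rw [Submodule.map_span]
      congr 1
      ext x
      constructor
      · rintro ⟨_, ⟨l, m, rfl⟩, rfl⟩
        exact ⟨γ l, m.1.2, congrArg Prod.snd (hact l m)⟩
      · rintro ⟨l, m, rfl⟩
        have h : E₂.σ m ∈ M₂ := E₂.range_σ.le ⟨m, rfl⟩
        obtain ⟨y, hy, h⟩ := hM.ge h
        obtain ⟨m₁, rfl⟩ := E₁.range_σ.ge hy
        refine ⟨_, ⟨γ.symm l, ⟨(m₁, m), (hbar _ _).2 h⟩, rfl⟩, ?_⟩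
        refine (congrArg Prod.snd (hact (γ.symm l) _)).trans ?_
        simp
    · rw [hEσ]; exact hbar' m
    · intro x hx y hy hxy
      obtain ⟨h1, e1⟩ := hgraph x hx
      obtain ⟨h2, e2⟩ := hgraph y hy
      have hxy' : x.1.2 = y.1.2 := hxy
      refine Subtype.ext (Prod.ext ?_ hxy')
      rw [← e1, ← e2] at hxy'
      exact congrArg Subtype.val (β'.injective (Subtype.ext hxy'))
    · intro l₁ m₁ l₂ m₂ h1 h2
      have e1 : γ (E₁.σ (E₁.HM.a m₁.1.1)) = E₂.σ (E₂.HM.a m₁.1.2) := by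
        rw [E₁.σ_a, E₂.σ_a, hγa, hbar']
      have e2 : γ (E₁.σ (E₁.HM.a m₁.1.1)) = E₂.σ (E₂.HM.a m₂) := by
        have : γ (Ehat.σ (Ehat.HM.a m₁)) = E₂.σ (E₂.HM.a m₂) := h1
        rw [hEσ, hEa] at this
        exact this
      have q1 := hβ l₁ _ _ _ e1 (hγa l₁) (hmem₁ _ _)
      have q2 := hβ l₁ _ _ _ e2 h2 (hmem₁ _ _)
      exact (congrArg Prod.snd (hact l₁ m₁)).trans (q1.symm.trans q2)
end

section
/- Let σ:(M*,α_*)→(L,α_L) be a relative central extension of the pair of regular Hom-Lie algebras (M,L) and let f be a factor set on σ. Then Ker σ × M equipped with the bracket [(x₁,m₁),(x₂,m₂)] = (f(m₁,m₂), [m₁,m₂]) and the linear map α_f(x,m) = (α_*(x), α_L(m)) is a Hom-Lie algebra. -/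
/-- Lemma 3.3: for a factor set f on σ, the space Ker σ × M with bracket
[(x₁,m₁),(x₂,m₂)] = (f(m₁,m₂),[m₁,m₂]) and twist α_f(x,m) = (α_*(x), α_L(m)) is a
Hom-Lie algebra. -/
theorem stmt_7 {K L Mstar : Type} [Field K] [AddCommGroup L] [Module K L]
    [AddCommGroup Mstar] [Module K Mstar]
    {HL : HomLie K L} {M : Submodule K L}
    (hreg : HL.IsRegular) (hid : HL.IsIdeal M)
    (E : RelCentExt K L Mstar HL M)
    (fs : FactorSet E) :
    ∃ H : HomLie K (↥(LinearMap.ker E.σ) × ↥M),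
      (∀ p q : ↥(LinearMap.ker E.σ) × ↥M,
          ((H.br p q).1 : Mstar) = fs.f (p.2 : L) (q.2 : L) ∧
          ((H.br p q).2 : L) = HL.br (p.2 : L) (q.2 : L)) ∧
      (∀ p : ↥(LinearMap.ker E.σ) × ↥M,
          ((H.a p).1 : Mstar) = E.HM.a (p.1 : Mstar) ∧ ((H.a p).2 : L) = HL.a (p.2 : L)) := by
  have fskew : ∀ x y, fs.f x y = - fs.f y x := by
    intro x y
    have h := fs.alt (x + y)
    simp only [map_add, LinearMap.add_apply, fs.alt, zero_add, add_zero] at h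
    first
      | exact eq_neg_of_add_eq_zero_left h
      | exact eq_neg_of_add_eq_zero_right h
  have hka : ∀ x ∈ LinearMap.ker E.σ, E.HM.a x ∈ LinearMap.ker E.σ := by
    intro x hx
    rw [LinearMap.mem_ker] at hx ⊢
    rw [E.σ_a, hx, map_zero]
  refine ⟨{ br := LinearMap.mk₂ K
              (fun p q => (⟨fs.f (p.2 : L) (q.2 : L), fs.mem_ker _ _⟩,
                ⟨HL.br (p.2 : L) (q.2 : L), hid.2 _ p.2.2 _⟩))
              ?_ ?_ ?_ ?_
            a := (E.HM.a.restrict hka).prodMap (HL.a.restrict hid.1)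
            skew := ?_
            jacobi := ?_ }, ?_, ?_⟩
  · intro p p' q
    ext <;> simp
  · intro c p q
    ext <;> simp
  · intro p q q'
    ext <;> simp
  · intro c p q
    ext <;> simp
  · intro p q
    ext
    · simpa using fskew _ _
    · simpa using HL.skew _ _
  · intro p q r
    ext
    · have h := fs.jac (p.2 : L) (q.2 : L) (r.2 : L)
      have h1 := fskew (HL.a p.2) (HL.br q.2 r.2)
      have h2 := fskew (HL.a q.2) (HL.br r.2 p.2)
      have h3 := fskew (HL.a r.2) (HL.br p.2 q.2)
      simp only [LinearMap.mk₂_apply, LinearMap.prodMap_apply, Prod.fst_add,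
        Submodule.coe_add, LinearMap.restrict_coe_apply, Prod.fst_zero, Submodule.coe_zero]
      rw [h1, h2, h3, ← neg_eq_zero, ← h]
      abel
    · simpa using HL.jacobi (p.2 : L) (q.2 : L) (r.2 : L)
  · intro p q
    exact ⟨rfl, rfl⟩
  · intro p
    exact ⟨rfl, rfl⟩
end

section
/- Let σ₁:(M₁*,α₁*)→(L₁,α₁) and σ₂:(M₂*,α₂*)→(L₂,α₂) be relative central extensions of the pairs (M₁,L₁) and (M₂,L₂) of finite dimensional regular Hom-Lie algebras. If σ₁ and σ₂ are isoclinic stem relative central extensions, then Ker σ₁ ≅ Ker σ₂; in particular, if M₁* and M₂* are finite dimensional, then dim M₁* = dim M₂*. -/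
/-- Lemma 3.5(2): if σ₁ and σ₂ are isoclinic stem relative central
extensions of pairs of finite dimensional regular Hom-Lie algebras, then
Ker σ₁ ≅ Ker σ₂ as Hom-Lie algebras; in particular, if M₁* and M₂* are finite
dimensional, then dim M₁* = dim M₂*. -/
theorem stmt_10 {K L₁ L₂ M₁s M₂s : Type} [Field K]
    [AddCommGroup L₁] [Module K L₁] [AddCommGroup L₂] [Module K L₂]
    [AddCommGroup M₁s] [Module K M₁s] [AddCommGroup M₂s] [Module K M₂s]
    {HL₁ : HomLie K L₁} {HL₂ : HomLie K L₂}
    {M₁ : Submodule K L₁} {M₂ : Submodule K L₂}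
    (hreg₁ : HL₁.IsRegular) (hid₁ : HL₁.IsIdeal M₁)
    (hreg₂ : HL₂.IsRegular) (hid₂ : HL₂.IsIdeal M₂)
    (E₁ : RelCentExt K L₁ M₁s HL₁ M₁) (E₂ : RelCentExt K L₂ M₂s HL₂ M₂)
    [FiniteDimensional K L₁] [FiniteDimensional K L₂]
    (hstem₁ : E₁.IsStem) (hstem₂ : E₂.IsStem)
    (hiso : AreIsoclinic E₁ E₂) :
    (∃ e : ↥(LinearMap.ker E₁.σ) ≃ₗ[K] ↥(LinearMap.ker E₂.σ),
      (∀ (x y : M₁s) (hx : x ∈ LinearMap.ker E₁.σ) (hy : y ∈ LinearMap.ker E₁.σ)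
          (hxy : E₁.HM.br x y ∈ LinearMap.ker E₁.σ),
          (e ⟨E₁.HM.br x y, hxy⟩ : M₂s) = E₂.HM.br (e ⟨x, hx⟩ : M₂s) (e ⟨y, hy⟩ : M₂s)) ∧
      (∀ (x : M₁s) (hx : x ∈ LinearMap.ker E₁.σ) (hax : E₁.HM.a x ∈ LinearMap.ker E₁.σ),
          (e ⟨E₁.HM.a x, hax⟩ : M₂s) = E₂.HM.a (e ⟨x, hx⟩ : M₂s))) ∧
    (FiniteDimensional K M₁s → FiniteDimensional K M₂s →
      Module.finrank K M₁s = Module.finrank K M₂s) := by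
  obtain ⟨γ, β, ⟨hγb, hγa⟩, hM, hbr, ha, hact⟩ := hiso
  simp only [LinearEquiv.coe_coe] at hγb hγa
  have key : ∀ x : E₁.comm, γ (E₁.σ x) = E₂.σ (β x) := by
    rintro ⟨x, hx⟩
    refine Submodule.span_induction (p := fun x hx => γ (E₁.σ x) = E₂.σ (β ⟨x, hx⟩))
      ?_ ?_ ?_ ?_ hx
    · rintro _ ⟨l, m, rfl⟩
      have h1 : γ (E₁.σ m) ∈ LinearMap.range E₂.σ := by
        rw [E₂.range_σ, ← hM]
        exact ⟨E₁.σ m, E₁.range_σ.le ⟨m, rfl⟩, rfl⟩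
      obtain ⟨m₂, hm₂⟩ := h1
      have h2 : γ (E₁.σ (E₁.HM.a m)) = E₂.σ (E₂.HM.a m₂) := by
        rw [E₁.σ_a, E₂.σ_a, hm₂, hγa]
      have h3 := hact l m (γ l) m₂ h2 (hγa l) (Submodule.subset_span ⟨l, m, rfl⟩)
      refine Eq.trans ?_ (congrArg E₂.σ h3).symm
      rw [E₁.σ_act, E₂.σ_act, hγb, h2, hγa]
    · have : (⟨0, E₁.comm.zero_mem⟩ : E₁.comm) = 0 := rfl
      erw [this]
      simp
    · intro x y hx hy h1 h2
      have : (⟨x + y, E₁.comm.add_mem hx hy⟩ : E₁.comm) = ⟨x, hx⟩ + ⟨y, hy⟩ := rfl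
      erw [this]
      rw [map_add, map_add, h1, h2, map_add, Submodule.coe_add, map_add]
    · intro c x hx h1
      have : (⟨c • x, E₁.comm.smul_mem c hx⟩ : E₁.comm) = c • ⟨x, hx⟩ := rfl
      erw [this]
      rw [map_smul, map_smul, h1, map_smul, Submodule.coe_smul, map_smul]
  let f : LinearMap.ker E₁.σ →ₗ[K] LinearMap.ker E₂.σ :=
    (E₂.comm.subtype ∘ₗ β.toLinearMap ∘ₗ Submodule.inclusion hstem₁).codRestrict _ (by
      intro x
      have h := key (Submodule.inclusion hstem₁ x)
      have hx : E₁.σ (x : M₁s) = 0 := x.2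
      have h0 : γ (E₁.σ (x : M₁s)) = 0 := by rw [hx, map_zero]
      exact h.symm.trans h0)
  have hf : ∀ (x : M₁s) (hx : x ∈ LinearMap.ker E₁.σ),
      (f ⟨x, hx⟩ : M₂s) = β ⟨x, hstem₁ hx⟩ := fun x hx => rfl
  have hbij : Function.Bijective f := by
    constructor
    · rintro ⟨x, hx⟩ ⟨y, hy⟩ h
      have h' := congrArg Subtype.val h
      rw [hf, hf] at h'
      have := β.injective (Subtype.ext h')
      exact Subtype.ext (Subtype.mk.inj this)
    · rintro ⟨y, hy⟩
      have hk := key (β.symm ⟨y, hstem₂ hy⟩)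
      rw [β.apply_symm_apply] at hk
      have hy' : E₂.σ y = 0 := hy
      have hx : (β.symm ⟨y, hstem₂ hy⟩ : M₁s) ∈ LinearMap.ker E₁.σ :=
        γ.injective (by rw [hk, map_zero]; exact hy')
      refine ⟨⟨_, hx⟩, Subtype.ext ?_⟩
      rw [hf]
      simp
  let e := LinearEquiv.ofBijective f hbij
  refine ⟨⟨e, ?_, ?_⟩, ?_⟩
  · intro x y hx hy hxy
    exact hbr ⟨x, hstem₁ hx⟩ ⟨y, hstem₁ hy⟩ (hstem₁ hxy)
  · intro x hx hax
    exact ha ⟨x, hstem₁ hx⟩ (hstem₁ hax)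
  · intro _ _
    rw [← LinearMap.finrank_range_add_finrank_ker E₁.σ,
      ← LinearMap.finrank_range_add_finrank_ker E₂.σ, e.finrank_eq, E₁.range_σ, E₂.range_σ]
    congr 1
    exact (γ.submoduleMap M₁).finrank_eq.trans (by rw [← hM])
end
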